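/- Let 1 ≤ a < b < ∞, α, β ∈ (0,1), C₁, C₂ > 0, and define f : ℝ → ℝ by f(x) = 1_{{0<|x|<1}} |x|^{−1/b} exp( C₁ |log|x||^{1−β} ) + 1_{{|x|≥1}} |x|^{−1/a} exp( C₂ (log|x|)^{1−α} ). Then |f|_p < ∞ for every p ∈ (a,b) and there exist constants 0 < c₁ ≤ c₂ < ∞ such that for all p ∈ (a,b): c₁ [ (p−a)^{1−1/α} + (b−p)^{1−1/β} ] ≤ log |f|_p ≤ c₂ [ (p−a)^{1−1/α} + (b−p)^{1−1/β} ]. -/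

import Mathlib

open MeasureTheory Filter Set
open scoped Topology

lemma sp_upper_pt (α s q q₁ t : ℝ) (h0 : 0 < α) (h1 : α < 1) (hs : 0 < s) (hq₁ : 0 < q₁)
    (hq : q ≤ q₁) (ht : 0 < t) :
    -s * t + q * t ^ (1 - α) ≤ -(s / 2) * t + q₁ * (2 * q₁) ^ (1 / α - 1) * s ^ (1 - 1 / α) := by
  have hX : 0 < q₁ * (2 * q₁) ^ (1 / α - 1) * s ^ (1 - 1 / α) := by positivity
  have hle : q * t ^ (1 - α) ≤ q₁ * t ^ (1 - α) := by gcongr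
  rcases le_or_gt (t ^ α) (2 * q₁ / s) with h | h
  · have e : t ^ (1 - α) ≤ (2 * q₁) ^ (1 / α - 1) * s ^ (1 - 1 / α) := by
      have e1 : t ^ (1 - α) = (t ^ α) ^ (1 / α - 1) := by
        rw [← Real.rpow_mul ht.le]; congr 1; field_simp
      have hd : 0 ≤ 1 / α - 1 := by
        rw [sub_nonneg, le_div_iff₀ h0]; linarith
      rw [e1]
      calc (t ^ α) ^ (1 / α - 1) ≤ (2 * q₁ / s) ^ (1 / α - 1) := by gcongr
        _ = _ := by
          rw [Real.div_rpow (by positivity) hs.le, div_eq_mul_inv, ← Real.rpow_neg hs.le, neg_sub]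
    have : q₁ * t ^ (1 - α) ≤ q₁ * ((2 * q₁) ^ (1 / α - 1) * s ^ (1 - 1 / α)) := by gcongr
    have : 0 < s * t := by positivity
    nlinarith
  · rw [div_lt_iff₀ hs] at h
    have e : t = t ^ α * t ^ (1 - α) := by
      rw [← Real.rpow_add ht]; simp
    have hp : 0 < t ^ (1 - α) := by positivity
    have : q₁ * t ^ (1 - α) ≤ s / 2 * t := by
      calc q₁ * t ^ (1 - α) ≤ (s / 2 * t ^ α) * t ^ (1 - α) := by gcongr; linarith
        _ = s / 2 * (t ^ α * t ^ (1 - α)) := by ring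
        _ = _ := by rw [← e]
    linarith

lemma sp_lower_pt (α s q q₀ t : ℝ) (h0 : 0 < α) (hs : 0 < s) (hq₀ : 0 < q₀)
    (hq : q₀ ≤ q) (ht : 0 < t) (hT : t ≤ (q₀ / (2 * s)) ^ (1 / α)) :
    s * t ≤ -s * t + q * t ^ (1 - α) := by
  have h : t ^ α ≤ q₀ / (2 * s) := by
    calc t ^ α ≤ ((q₀ / (2 * s)) ^ (1 / α)) ^ α := by gcongr
      _ = _ := by rw [← Real.rpow_mul (by positivity), one_div_mul_cancel h0.ne', Real.rpow_one]
  rw [le_div_iff₀ (by positivity)] at h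
  have e : t = t ^ α * t ^ (1 - α) := by
    rw [← Real.rpow_add ht]; simp
  have hp : 0 < t ^ (1 - α) := by positivity
  have : 2 * s * t ≤ q * t ^ (1 - α) := by
    calc 2 * s * t = 2 * s * (t ^ α * t ^ (1 - α)) := by rw [← e]
      _ = (t ^ α * (2 * s)) * t ^ (1 - α) := by ring
      _ ≤ q * t ^ (1 - α) := by gcongr; linarith
  linarith

lemma sp_absorb (α S : ℝ) (h0 : 0 < α) (h1 : α < 1) (hS : 0 < S) :
    ∃ K : ℝ, 0 < K ∧ ∀ s, 0 < s → s ≤ S → 8 / s ≤ Real.exp (K * s ^ (1 - 1 / α)) := by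
  have hd : 0 < 1 / α - 1 := by
    rw [sub_pos, lt_div_iff₀ h0]; linarith
  have hl : 0 < Real.log 8 := Real.log_pos (by norm_num)
  refine ⟨1 / (1 / α - 1) + Real.log 8 / S ^ (1 - 1 / α), by positivity, fun s hs hsS => ?_⟩
  have hX : 0 < s ^ (1 - 1 / α) := by positivity
  have hXS : S ^ (1 - 1 / α) ≤ s ^ (1 - 1 / α) :=
    Real.rpow_le_rpow_of_nonpos hs hsS (by linarith)
  rw [← Real.log_le_iff_le_exp (by positivity), Real.log_div (by norm_num) hs.ne', add_mul]
  have a1 : Real.log 8 ≤ Real.log 8 / S ^ (1 - 1 / α) * s ^ (1 - 1 / α) := by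
    rw [div_mul_eq_mul_div, le_div_iff₀ (by positivity)]; gcongr
  have a2 : -Real.log s ≤ 1 / (1 / α - 1) * s ^ (1 - 1 / α) := by
    have := Real.log_le_sub_one_of_pos hX
    rw [Real.log_rpow hs] at this
    rw [one_div_mul_eq_div, le_div_iff₀ hd]
    nlinarith
  linarith

lemma sp_core (α S q₀ q₁ : ℝ) (h0 : 0 < α) (h1 : α < 1) (hS : 0 < S) (hq₀ : 0 < q₀)
    (hq₁ : 0 < q₁) :
    ∃ k K : ℝ, 0 < k ∧ 0 < K ∧ ∀ s q, 0 < s → s ≤ S → q₀ ≤ q → q ≤ q₁ →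
      IntegrableOn (fun t : ℝ => Real.exp (-s * t + q * t ^ (1 - α))) (Ioi 0) ∧
      Real.exp (k * s ^ (1 - 1 / α)) ≤
        1 + ∫ t in Ioi (0 : ℝ), Real.exp (-s * t + q * t ^ (1 - α)) ∧
      1 / s ≤ ∫ t in Ioi (0 : ℝ), Real.exp (-s * t + q * t ^ (1 - α)) ∧
      4 * ∫ t in Ioi (0 : ℝ), Real.exp (-s * t + q * t ^ (1 - α)) ≤
        Real.exp (K * s ^ (1 - 1 / α)) := by
  obtain ⟨K, hK, hK'⟩ := sp_absorb α S h0 h1 hS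
  set T₀ := (q₀ / (2 * S)) ^ (1 / α) with hT₀
  have hT₀p : 0 < T₀ := by positivity
  set ε := min 1 (T₀ / 2) with hε
  have hεp : 0 < ε := by positivity
  have hε1 : ε ≤ 1 := min_le_left _ _
  have hε2 : ε ≤ T₀ / 2 := min_le_right _ _
  refine ⟨ε * ((q₀ / 2) ^ (1 / α) / 2), K + q₁ * (2 * q₁) ^ (1 / α - 1), by positivity,
    by positivity, fun s q hs hsS hq hq' => ?_⟩
  have hdom : ∀ t ∈ Ioi (0 : ℝ), Real.exp (-s * t + q * t ^ (1 - α)) ≤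
      Real.exp (q₁ * (2 * q₁) ^ (1 / α - 1) * s ^ (1 - 1 / α)) * Real.exp (-(s / 2) * t) := by
    intro t ht
    rw [← Real.exp_add, Real.exp_le_exp]
    have := sp_upper_pt α s q q₁ t h0 h1 hs hq₁ hq' ht
    linarith
  have hint2 : IntegrableOn (fun t : ℝ =>
      Real.exp (q₁ * (2 * q₁) ^ (1 / α - 1) * s ^ (1 - 1 / α)) * Real.exp (-(s / 2) * t))
      (Ioi 0) :=
    (integrableOn_exp_mul_Ioi (by linarith) 0).const_mul _
  have hint : IntegrableOn (fun t : ℝ => Real.exp (-s * t + q * t ^ (1 - α))) (Ioi 0) := by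
    refine Integrable.mono' hint2 ?_ ?_
    · exact (by fun_prop : Measurable _).aestronglyMeasurable
    · filter_upwards [ae_restrict_mem measurableSet_Ioi] with t ht
      rw [Real.norm_eq_abs, abs_of_pos (Real.exp_pos _)]
      exact hdom t ht
  refine ⟨hint, ?_, ?_, ?_⟩
  · set T := (q₀ / (2 * s)) ^ (1 / α) with hT
    have hTp : 0 < T := by positivity
    have hTT : T₀ ≤ T := by rw [hT, hT₀]; gcongr
    have hsT : s * T = (q₀ / 2) ^ (1 / α) * s ^ (1 - 1 / α) := by
      rw [hT, ← div_div, Real.div_rpow (by positivity) hs.le, Real.rpow_sub hs, Real.rpow_one]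
      field_simp
    have hlow : T / 2 * Real.exp (s * T / 2) ≤
        ∫ t in Ioi (0 : ℝ), Real.exp (-s * t + q * t ^ (1 - α)) := by
      have hsub : Ioc (T / 2) T ⊆ Ioi 0 := fun t ht => lt_trans (by positivity) ht.1
      calc T / 2 * Real.exp (s * T / 2) = ∫ t in Ioc (T / 2) T, Real.exp (s * T / 2) := by
            rw [setIntegral_const]; simp [Measure.real, hTp.le]
            ring
        _ ≤ ∫ t in Ioc (T / 2) T, Real.exp (-s * t + q * t ^ (1 - α)) := by
            refine setIntegral_mono_on (by simp) (hint.mono_set hsub) measurableSet_Ioc ?_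
            intro t ht
            rw [Real.exp_le_exp]
            have := sp_lower_pt α s q q₀ t h0 hs hq₀ hq (hsub ht) ht.2
            have := ht.1
            nlinarith
        _ ≤ _ := setIntegral_mono_set hint (Eventually.of_forall fun t => (Real.exp_pos _).le)
            (Eventually.of_forall hsub)
    have hconv := convexOn_exp.2 (mem_univ 0) (mem_univ (s * T / 2))
      (sub_nonneg.2 hε1) hεp.le (by ring)
    simp only [smul_eq_mul, mul_zero, zero_add, Real.exp_zero, mul_one] at hconv
    have e : ε * ((q₀ / 2) ^ (1 / α) / 2) * s ^ (1 - 1 / α) = ε * (s * T / 2) := by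
      rw [hsT]; ring
    rw [e]
    have : ε * Real.exp (s * T / 2) ≤ T / 2 * Real.exp (s * T / 2) := by
      gcongr; linarith
    linarith
  · calc 1 / s = ∫ t in Ioi (0 : ℝ), Real.exp (-s * t) := by
          rw [integral_exp_mul_Ioi (by linarith)]; simp
      _ ≤ _ := by
        refine setIntegral_mono_on (integrableOn_exp_mul_Ioi (by linarith) 0) hint
          measurableSet_Ioi ?_
        intro t ht
        rw [Real.exp_le_exp]
        have : 0 ≤ q * t ^ (1 - α) := mul_nonneg (by linarith) (Real.rpow_nonneg (le_of_lt ht) _)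
        linarith
  · have h : ∫ t in Ioi (0 : ℝ), Real.exp (-s * t + q * t ^ (1 - α)) ≤
        Real.exp (q₁ * (2 * q₁) ^ (1 / α - 1) * s ^ (1 - 1 / α)) * (2 / s) := by
      calc _ ≤ ∫ t in Ioi (0 : ℝ),
            Real.exp (q₁ * (2 * q₁) ^ (1 / α - 1) * s ^ (1 - 1 / α)) * Real.exp (-(s / 2) * t) :=
            setIntegral_mono_on hint hint2 measurableSet_Ioi hdom
        _ = _ := by
            rw [integral_const_mul, integral_exp_mul_Ioi (by linarith)]; simp
    rw [add_mul, Real.exp_add]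
    calc _ ≤ 4 * (Real.exp (q₁ * (2 * q₁) ^ (1 / α - 1) * s ^ (1 - 1 / α)) * (2 / s)) := by gcongr
      _ = 8 / s * Real.exp (q₁ * (2 * q₁) ^ (1 / α - 1) * s ^ (1 - 1 / α)) := by ring
      _ ≤ _ := by gcongr; exact hK' s hs hsS

lemma sp_cov (h F G : ℝ → ℝ) (heven : ∀ x, h |x| = h x)
    (hF : ∀ t > 0, Real.exp (-t) * h (Real.exp (-t)) = F t)
    (hG : ∀ t > 0, Real.exp t * h (Real.exp t) = G t)
    (iF : IntegrableOn F (Ioi 0)) (iG : IntegrableOn G (Ioi 0)) :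
    Integrable h ∧ ∫ x, h x = 2 * ((∫ t in Ioi 0, F t) + ∫ t in Ioi 0, G t) := by
  have im1 : (fun t : ℝ => Real.exp (-t)) '' Ioi 0 = Ioo 0 1 := by
    ext x
    simp only [mem_image, mem_Ioi, mem_Ioo]
    constructor
    · rintro ⟨t, ht, rfl⟩
      exact ⟨Real.exp_pos _, by rw [Real.exp_lt_one_iff]; linarith⟩
    · rintro ⟨hx, hx1⟩
      exact ⟨-Real.log x, by have := Real.log_neg hx hx1; linarith, by rw [neg_neg, Real.exp_log hx]⟩
  have im2 : Real.exp '' Ioi 0 = Ioi 1 := by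
    ext x
    simp only [mem_image, mem_Ioi]
    constructor
    · rintro ⟨t, ht, rfl⟩
      rwa [Real.one_lt_exp_iff]
    · intro hx
      exact ⟨Real.log x, Real.log_pos hx, Real.exp_log (by linarith)⟩
  have d1 : ∀ x ∈ Ioi (0 : ℝ), HasDerivWithinAt (fun t : ℝ => Real.exp (-t)) (-Real.exp (-x)) (Ioi 0) x := by
    intro x _
    have := (hasDerivAt_neg x).exp
    simpa using this.hasDerivWithinAt
  have d2 : ∀ x ∈ Ioi (0 : ℝ), HasDerivWithinAt Real.exp (Real.exp x) (Ioi 0) x :=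
    fun x _ => (Real.hasDerivAt_exp x).hasDerivWithinAt
  have j1 : InjOn (fun t : ℝ => Real.exp (-t)) (Ioi 0) := by
    intro x _ y _ hxy
    have := Real.exp_injective hxy
    linarith
  have j2 : InjOn Real.exp (Ioi 0) := Real.exp_injective.injOn
  have c1 : EqOn (fun x => |-Real.exp (-x)| • h (Real.exp (-x))) F (Ioi 0) := by
    intro x hx
    simp only [abs_neg, abs_of_pos (Real.exp_pos _), smul_eq_mul]
    exact hF x hx
  have c2 : EqOn (fun x => |Real.exp x| • h (Real.exp x)) G (Ioi 0) := by
    intro x hx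
    simp only [abs_of_pos (Real.exp_pos _), smul_eq_mul]
    exact hG x hx
  have i1 : IntegrableOn h (Ioo 0 1) := by
    rw [← im1, integrableOn_image_iff_integrableOn_abs_deriv_smul measurableSet_Ioi d1 j1,
      integrableOn_congr_fun c1 measurableSet_Ioi]
    exact iF
  have i2 : IntegrableOn h (Ioi 1) := by
    rw [← im2, integrableOn_image_iff_integrableOn_abs_deriv_smul measurableSet_Ioi d2 j2,
      integrableOn_congr_fun c2 measurableSet_Ioi]
    exact iG
  have e1 : ∫ x in Ioo 0 1, h x = ∫ t in Ioi 0, F t := by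
    rw [← im1, integral_image_eq_integral_abs_deriv_smul measurableSet_Ioi d1 j1]
    exact setIntegral_congr_fun measurableSet_Ioi c1
  have e2 : ∫ x in Ioi 1, h x = ∫ t in Ioi 0, G t := by
    rw [← im2, integral_image_eq_integral_abs_deriv_smul measurableSet_Ioi d2 j2]
    exact setIntegral_congr_fun measurableSet_Ioi c2
  have hU : Ioi (0 : ℝ) = Ioo 0 1 ∪ Ici 1 := (Ioo_union_Ici_eq_Ioi one_pos).symm
  have i3 : IntegrableOn h (Ici 1) := by
    rw [integrableOn_Ici_iff_integrableOn_Ioi]; exact i2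
  have i0 : IntegrableOn h (Ioi 0) := by
    rw [hU]; exact i1.union i3
  have iN : IntegrableOn h (Iio 0) := by
    have : IntegrableOn (fun x => h (-x)) (Iio 0) := by
      apply IntegrableOn.comp_neg_Iio
      simpa using i0
    refine this.congr_fun (fun x _ => ?_) measurableSet_Iio
    show h (-x) = h x
    rw [← heven (-x), abs_neg, heven]
  constructor
  · rw [← integrableOn_univ, ← Iio_union_Ici (a := (0 : ℝ))]
    refine iN.union ?_
    rw [integrableOn_Ici_iff_integrableOn_Ioi]; exact i0
  · have : ∫ x, h x = ∫ x, h |x| := by simp_rw [heven]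
    have e0 : ∫ x in Ioi 0, h x = (∫ x in Ioo 0 1, h x) + ∫ x in Ici 1, h x := by
      rw [hU]
      refine setIntegral_union ?_ measurableSet_Ici i1 i3
      exact Set.disjoint_left.2 fun x hx hx' => absurd hx.2 (not_lt.2 hx')
    rw [this, integral_comp_abs, e0, e1, integral_Ici_eq_integral_Ioi, e2]

/-- Blow-up rate of `|f|_p` at both endpoints of `(a,b)` for the example
`f(x) = 1_{{0<|x|<1}}|x|^{-1/b} exp(C₁|log|x||^{1-β}) + 1_{{|x|≥1}}|x|^{-1/a} exp(C₂(log|x|)^{1-α})`: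
`log |f|_p ≍ (p-a)^{1-1/α} + (b-p)^{1-1/β}` on `(a,b)`. -/
theorem example_saddle_point (a b α β C₁ C₂ : ℝ) (ha : 1 ≤ a) (hab : a < b)
    (hα : α ∈ Set.Ioo (0 : ℝ) 1) (hβ : β ∈ Set.Ioo (0 : ℝ) 1)
    (hC₁ : 0 < C₁) (hC₂ : 0 < C₂)
    (f : ℝ → ℝ)
    (hf : ∀ x, f x =
      Set.indicator {x : ℝ | 0 < |x| ∧ |x| < 1}
        (fun x => |x| ^ (-(1 / b)) * Real.exp (C₁ * (abs (Real.log |x|)) ^ (1 - β))) x +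
      Set.indicator {x : ℝ | 1 ≤ |x|}
        (fun x => |x| ^ (-(1 / a)) * Real.exp (C₂ * Real.log |x| ^ (1 - α))) x) :
    (∀ p ∈ Set.Ioo a b, Integrable (fun x : ℝ => |f x| ^ p)) ∧
    ∃ c₁ c₂ : ℝ, 0 < c₁ ∧ c₁ ≤ c₂ ∧ ∀ p ∈ Set.Ioo a b,
      c₁ * ((p - a) ^ (1 - 1 / α) + (b - p) ^ (1 - 1 / β)) ≤
        Real.log ((∫ x : ℝ, |f x| ^ p) ^ (1 / p)) ∧
      Real.log ((∫ x : ℝ, |f x| ^ p) ^ (1 / p)) ≤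
        c₂ * ((p - a) ^ (1 - 1 / α) + (b - p) ^ (1 - 1 / β)) := by
  obtain ⟨hα0, hα1⟩ := hα
  obtain ⟨hβ0, hβ1⟩ := hβ
  have ha0 : 0 < a := by linarith
  have hb0 : 0 < b := by linarith
  have hba : 0 < b - a := by linarith
  obtain ⟨k₁, K₁, hk₁, hK₁, H₁⟩ := sp_core β ((b - a) / b) C₁ (b * C₁) hβ0 hβ1 (by positivity)
    hC₁ (by positivity)
  obtain ⟨k₂, K₂, hk₂, hK₂, H₂⟩ := sp_core α ((b - a) / a) C₂ (b * C₂) hα0 hα1 (by positivity)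
    hC₂ (by positivity)
  have key : ∀ p ∈ Set.Ioo a b, Integrable (fun x : ℝ => |f x| ^ p) ∧
      ∫ x : ℝ, |f x| ^ p =
        2 * ((∫ t in Ioi (0 : ℝ), Real.exp (-((b - p) / b) * t + p * C₁ * t ^ (1 - β))) +
          ∫ t in Ioi (0 : ℝ), Real.exp (-((p - a) / a) * t + p * C₂ * t ^ (1 - α))) := by
    rintro p ⟨hpa, hpb⟩
    apply sp_cov
    · intro x
      simp only [hf, indicator, mem_ofPred_eq, abs_abs]
    · intro t ht
      have e1 : Real.exp (-t) < 1 := by rw [Real.exp_lt_one_iff]; linarith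
      have e2 : ¬ (1 ≤ Real.exp (-t)) := not_le.2 e1
      simp only [hf, indicator, mem_ofPred_eq, abs_of_pos (Real.exp_pos _), Real.exp_pos, e1, e2,
        Real.log_exp, abs_neg, abs_of_pos ht, if_true, if_false, and_self, add_zero]
      rw [← Real.exp_mul, ← Real.exp_add, abs_of_pos (Real.exp_pos _), ← Real.exp_mul,
        ← Real.exp_add]
      congr 1
      field_simp
      ring
    · intro t ht
      have e1 : 1 ≤ Real.exp t := Real.one_le_exp ht.le
      have e2 : ¬ (Real.exp t < 1) := not_lt.2 e1
      simp only [hf, indicator, mem_ofPred_eq, abs_of_pos (Real.exp_pos _), Real.exp_pos, e1, e2,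
        Real.log_exp, if_true, if_false, and_false, zero_add]
      rw [← Real.exp_mul, ← Real.exp_add, abs_of_pos (Real.exp_pos _), ← Real.exp_mul,
        ← Real.exp_add]
      congr 1
      field_simp
      ring
    · exact (H₁ ((b - p) / b) (p * C₁) (div_pos (by linarith) hb0) (by gcongr) (by nlinarith)
        (by gcongr)).1
    · exact (H₂ ((p - a) / a) (p * C₂) (div_pos (by linarith) ha0) (by gcongr) (by nlinarith)
        (by gcongr)).1
  refine ⟨fun p hp => (key p hp).1, ?_⟩
  set m₁ := (b ^ (1 - 1 / β))⁻¹ with hm₁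
  set m₂ := (a ^ (1 - 1 / α))⁻¹ with hm₂
  have hm₁p : 0 < m₁ := by positivity
  have hm₂p : 0 < m₂ := by positivity
  set c := min (k₁ * m₁) (k₂ * m₂) with hc
  have hcp : 0 < c := by positivity
  have hc1 : c ≤ k₁ * m₁ := min_le_left _ _
  have hc2 : c ≤ k₂ * m₂ := min_le_right _ _
  have hcb : 0 < c / (2 * b) := by positivity
  have hM₁ : 0 < K₁ * m₁ := by positivity
  have hM₂ : 0 < K₂ * m₂ := by positivity
  refine ⟨c / (2 * b), K₁ * m₁ + K₂ * m₂ + c / (2 * b), hcb, by linarith, fun p hp => ?_⟩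
  obtain ⟨-, hI⟩ := key p hp
  obtain ⟨hpa, hpb⟩ := hp
  have hp0 : 0 < p := by linarith
  obtain ⟨-, A1, A2, A3⟩ := H₁ ((b - p) / b) (p * C₁) (div_pos (by linarith) hb0) (by gcongr)
    (by nlinarith) (by gcongr)
  obtain ⟨-, B1, B2, B3⟩ := H₂ ((p - a) / a) (p * C₂) (div_pos (by linarith) ha0) (by gcongr)
    (by nlinarith) (by gcongr)
  rw [hI]
  set F := ∫ t in Ioi (0 : ℝ), Real.exp (-((b - p) / b) * t + p * C₁ * t ^ (1 - β))
  set G := ∫ t in Ioi (0 : ℝ), Real.exp (-((p - a) / a) * t + p * C₂ * t ^ (1 - α))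
  have hF1 : 1 ≤ F := by
    refine le_trans ?_ A2
    rw [one_div_div, le_div_iff₀ (by linarith)]
    linarith
  have hG0 : 0 < G := lt_of_lt_of_le (by have : 0 < p - a := by linarith
                                         positivity) B2
  have hX₁ : ((b - p) / b) ^ (1 - 1 / β) = m₁ * (b - p) ^ (1 - 1 / β) := by
    rw [Real.div_rpow (by linarith) hb0.le, hm₁]; ring
  have hX₂ : ((p - a) / a) ^ (1 - 1 / α) = m₂ * (p - a) ^ (1 - 1 / α) := by
    rw [Real.div_rpow (by linarith) ha0.le, hm₂]; ring
  rw [hX₁] at A1 A3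
  rw [hX₂] at B1 B3
  have hY₁ : 0 < (b - p) ^ (1 - 1 / β) := Real.rpow_pos_of_pos (by linarith) _
  have hY₂ : 0 < (p - a) ^ (1 - 1 / α) := Real.rpow_pos_of_pos (by linarith) _
  set Y₁ := (b - p) ^ (1 - 1 / β)
  set Y₂ := (p - a) ^ (1 - 1 / α)
  have hpos : 0 < 2 * (F + G) := by linarith
  rw [Real.log_rpow hpos]
  have L1 : k₁ * (m₁ * Y₁) ≤ Real.log (2 * (F + G)) := by
    rw [Real.le_log_iff_exp_le hpos]; linarith
  have L2 : k₂ * (m₂ * Y₂) ≤ Real.log (2 * (F + G)) := by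
    rw [Real.le_log_iff_exp_le hpos]; linarith
  have L0 : 0 ≤ Real.log (2 * (F + G)) := Real.log_nonneg (by linarith)
  have U : Real.log (2 * (F + G)) ≤ K₁ * (m₁ * Y₁) + K₂ * (m₂ * Y₂) := by
    rw [Real.log_le_iff_le_exp hpos, Real.exp_add]
    have x1 : 1 ≤ Real.exp (K₁ * (m₁ * Y₁)) := Real.one_le_exp (by positivity)
    have x2 : 1 ≤ Real.exp (K₂ * (m₂ * Y₂)) := Real.one_le_exp (by positivity)
    nlinarith
  set L := Real.log (2 * (F + G))
  constructor
  · have h1 : c * Y₁ ≤ k₁ * m₁ * Y₁ := by gcongr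
    have h2 : c * Y₂ ≤ k₂ * m₂ * Y₂ := by gcongr
    have h3 : c * (Y₂ + Y₁) / 2 ≤ L := by linarith
    calc c / (2 * b) * (Y₂ + Y₁) = 1 / b * (c * (Y₂ + Y₁) / 2) := by field_simp
      _ ≤ 1 / b * L := by gcongr
      _ ≤ 1 / p * L := by gcongr
  · have h1 : 1 / p * L ≤ L := by
      have : 1 / p ≤ 1 := by rw [div_le_one hp0]; linarith
      exact mul_le_of_le_one_left L0 this
    have g1 : 0 < K₁ * m₁ * Y₂ := by positivity
    have g2 : 0 < K₂ * m₂ * Y₁ := by positivity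
    have g3 : 0 < c / (2 * b) * (Y₂ + Y₁) := by positivity
    have g4 : (K₁ * m₁ + K₂ * m₂ + c / (2 * b)) * (Y₂ + Y₁) = K₁ * (m₁ * Y₁) + K₂ * (m₂ * Y₂) +
        K₁ * m₁ * Y₂ + K₂ * m₂ * Y₁ + c / (2 * b) * (Y₂ + Y₁) := by ring
    linarith
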